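/- arXiv:1608.00039 — 7 statements merged into one kernel-verified Lean document; each statement's English description precedes it below -/
import Mathlib

section
/- Suppose G : X → X is ν-strongly monotone and L-Lipschitz, where ν ≥ 0 and L ≥ 0. Then for all x, y ∈ X: ⟨x − y, U(G x − G y)⟩ ≥ μ_max·(ν − t·L)·‖x − y‖². In particular: (i) if G is ν-strongly monotone and (δ + ρδ_p)-Lipschitz, then ⟨x − y, U(G x − G y)⟩ ≥ μ_max·(ν − t(δ + ρδ_p))·‖x − y‖²; (ii) if G is merely monotone (ν = 0) and δ_p-Lipschitz, then ⟨x − y, U(G x − G y)⟩ ≥ −t·μ_max·δ_p·‖x − y‖². -/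
open scoped RealInnerProductSpace

/-- A vector of an `ℓ²` product whose blocks are bounded by `r` times the blocks of `x` has norm at
most `r * ‖x‖`. -/
theorem PiLp.norm_le_mul_norm_of_forall_norm_le {ι : Type*} [Fintype ι] {E : ι → Type*}
    [∀ i, SeminormedAddCommGroup (E i)] {r : ℝ} (hr : 0 ≤ r) {x y : PiLp 2 E}
    (h : ∀ i, ‖y i‖ ≤ r * ‖x i‖) : ‖y‖ ≤ r * ‖x‖ := by
  refine (sq_le_sq₀ (norm_nonneg _) (by positivity)).1 ?_
  rw [mul_pow, PiLp.norm_sq_eq_of_L2, PiLp.norm_sq_eq_of_L2, Finset.mul_sum]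
  refine Finset.sum_le_sum fun i _ => ?_
  rw [← mul_pow]
  gcongr
  exact h i

/-- **Lemma 2 of the paper: weighted strong monotonicity.**
With heterogeneous step-sizes `μ k > 0`, `μ_max = max_k μ k`, `min_k μ k = (1−t) μ_max`,
and the blockwise scaling `(U x) k = μ k • x k`, if `G` is `ν`-strongly monotone and
`L`-Lipschitz (`ν ≥ 0`, `L ≥ 0`) then
`⟪x − y, U (G x − G y)⟫ ≥ μ_max (ν − t L) ‖x − y‖²` for all `x, y`. -/
theorem weighted_strong_monotonicity
    {N : ℕ} (hN : 1 ≤ N) (E : Fin N → Type*)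
    [∀ k, NormedAddCommGroup (E k)] [∀ k, InnerProductSpace ℝ (E k)]
    [∀ k, FiniteDimensional ℝ (E k)]
    (μ : Fin N → ℝ) (hμpos : ∀ k, 0 < μ k)
    (μmax : ℝ) (hμmax : IsGreatest (Set.range μ) μmax)
    (t : ℝ) (ht0 : 0 ≤ t) (ht1 : t < 1)
    (hμmin : IsLeast (Set.range μ) ((1 - t) * μmax))
    (U : PiLp 2 E → PiLp 2 E) (hU : ∀ (x : PiLp 2 E) (k : Fin N), U x k = μ k • x k)
    (G : PiLp 2 E → PiLp 2 E) (ν L : ℝ) (hν : 0 ≤ ν) (hL : 0 ≤ L)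
    (hmono : ∀ x y : PiLp 2 E, ν * ‖x - y‖ ^ 2 ≤ ⟪x - y, G x - G y⟫)
    (hlip : ∀ x y : PiLp 2 E, ‖G x - G y‖ ≤ L * ‖x - y‖) :
    ∀ x y : PiLp 2 E, μmax * (ν - t * L) * ‖x - y‖ ^ 2 ≤ ⟪x - y, U (G x - G y)⟫ := by
  intro x y
  have hmax : 0 < μmax := by
    obtain ⟨k, rfl⟩ := hμmax.1
    exact hμpos k
  have htμ : 0 ≤ t * μmax := mul_nonneg ht0 hmax.le
  have hdev (b : PiLp 2 E) : ‖μmax • b - U b‖ ≤ t * μmax * ‖b‖ := by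
    refine PiLp.norm_le_mul_norm_of_forall_norm_le htμ fun k => ?_
    have hle : μ k ≤ μmax := hμmax.2 ⟨k, rfl⟩
    have hge : (1 - t) * μmax ≤ μ k := hμmin.2 ⟨k, rfl⟩
    rw [PiLp.sub_apply, PiLp.smul_apply, hU, ← sub_smul, norm_smul, Real.norm_of_nonneg (by linarith)]
    gcongr
    linarith
  have hinner : ⟪x - y, μmax • (G x - G y) - U (G x - G y)⟫ ≤
      ‖x - y‖ * (t * μmax * (L * ‖x - y‖)) := by
    refine (real_inner_le_norm _ _).trans ?_
    gcongr
    refine (hdev _).trans ?_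
    gcongr
    exact hlip x y
  rw [inner_sub_right, real_inner_smul_right] at hinner
  linarith [mul_le_mul_of_nonneg_left (hmono x y) hmax.le]
end

section
/- Let P : X → X be monotone and δ_p-Lipschitz, and let ρ ≥ 0. Then for all x, y ∈ X: ‖(x − y) − ρ•U(P x − P y)‖² ≤ (1 + 2t·μ_max·ρ·δ_p + μ_max²·ρ²·δ_p²)·‖x − y‖². -/
open scoped RealInnerProductSpace

/-- A blockwise scaling whose factors are bounded by `C` in absolute value increases the `ℓ²` norm
by a factor of at most `C`. -/
lemma PiLp.norm_le_mul_norm_of_forall_eq_smul {ι : Type*} [Fintype ι] {E : ι → Type*}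
    [∀ k, NormedAddCommGroup (E k)] [∀ k, InnerProductSpace ℝ (E k)]
    {c : ι → ℝ} {C : ℝ} (hC : 0 ≤ C) (hc : ∀ k, |c k| ≤ C) {v w : PiLp 2 E}
    (hv : ∀ k, v k = c k • w k) : ‖v‖ ≤ C * ‖w‖ := by
  refine (sq_le_sq₀ (norm_nonneg v) (by positivity)).mp ?_
  rw [mul_pow, PiLp.norm_sq_eq_of_L2, PiLp.norm_sq_eq_of_L2, Finset.mul_sum]
  refine Finset.sum_le_sum fun k _ => ?_
  rw [hv k, norm_smul, Real.norm_eq_abs, mul_pow]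
  gcongr
  exact hc k

/-- **penalty-step contraction estimate, Appendix E of the paper.**
If `P` is monotone and `δ_p`-Lipschitz and `ρ ≥ 0`, then
`‖(x − y) − ρ • U (P x − P y)‖² ≤ (1 + 2 t μ_max ρ δ_p + μ_max² ρ² δ_p²) ‖x − y‖²`. -/
theorem penalty_step_contraction
    {N : ℕ} (hN : 1 ≤ N) (E : Fin N → Type*)
    [∀ k, NormedAddCommGroup (E k)] [∀ k, InnerProductSpace ℝ (E k)]
    [∀ k, FiniteDimensional ℝ (E k)]
    (μ : Fin N → ℝ) (hμpos : ∀ k, 0 < μ k)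
    (μmax : ℝ) (hμmax : IsGreatest (Set.range μ) μmax)
    (t : ℝ) (ht0 : 0 ≤ t) (ht1 : t < 1)
    (hμmin : IsLeast (Set.range μ) ((1 - t) * μmax))
    (U : PiLp 2 E → PiLp 2 E) (hU : ∀ (x : PiLp 2 E) (k : Fin N), U x k = μ k • x k)
    (P : PiLp 2 E → PiLp 2 E) (δp : ℝ)
    (hPmono : ∀ x y : PiLp 2 E, 0 ≤ ⟪x - y, P x - P y⟫)
    (hPlip : ∀ x y : PiLp 2 E, ‖P x - P y‖ ≤ δp * ‖x - y‖)
    (ρ : ℝ) (hρ : 0 ≤ ρ) :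
    ∀ x y : PiLp 2 E,
      ‖(x - y) - ρ • U (P x - P y)‖ ^ 2 ≤
        (1 + 2 * t * μmax * ρ * δp + μmax ^ 2 * ρ ^ 2 * δp ^ 2) * ‖x - y‖ ^ 2 := by
  intro x y
  have hle : ∀ k, μ k ≤ μmax := fun k => hμmax.2 ⟨k, rfl⟩
  have hge : ∀ k, (1 - t) * μmax ≤ μ k := fun k => hμmin.2 ⟨k, rfl⟩
  have hmax : 0 ≤ μmax := (hμpos ⟨0, hN⟩).le.trans (hle _)
  have hmono := hPmono x y
  have hlip := hPlip x y
  generalize x - y = d at *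
  generalize P x - P y = g at *
  have hUg : ‖U g‖ ≤ μmax * ‖g‖ :=
    PiLp.norm_le_mul_norm_of_forall_eq_smul hmax
      (fun k => by rw [abs_of_pos (hμpos k)]; exact hle k) (hU g)
  have hdev : ‖μmax • g - U g‖ ≤ t * μmax * ‖g‖ :=
    PiLp.norm_le_mul_norm_of_forall_eq_smul (c := fun k => μmax - μ k) (by positivity)
      (fun k => by rw [abs_of_nonneg (sub_nonneg.2 (hle k))]; linarith [hge k])
      (fun k => by rw [PiLp.sub_apply, PiLp.smul_apply, hU, sub_smul])
  have hinner : -⟪d, U g⟫ ≤ t * μmax * δp * ‖d‖ ^ 2 := by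
    have hcs : ⟪d, μmax • g - U g⟫ ≤ ‖d‖ * (t * μmax * (δp * ‖d‖)) :=
      (real_inner_le_norm _ _).trans <| by
        gcongr
        exact hdev.trans (by gcongr)
    rw [inner_sub_right, real_inner_smul_right] at hcs
    nlinarith [mul_nonneg hmax hmono]
  have hsq : ‖U g‖ ^ 2 ≤ (μmax * (δp * ‖d‖)) ^ 2 := by
    gcongr
    exact hUg.trans (by gcongr)
  rw [norm_sub_sq_real, real_inner_smul_right, norm_smul, mul_pow, Real.norm_eq_abs, sq_abs]
  have h1 := mul_le_mul_of_nonneg_left hinner hρ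
  have h2 := mul_le_mul_of_nonneg_left hsq (sq_nonneg ρ)
  linear_combination 2 * h1 + h2
end

section
/- Let F : X → X be ν-strongly monotone and δ-Lipschitz, set ν'' = ν − t·δ. Then for all x, y ∈ X: ‖(x − y) − U(F x − F y)‖² ≤ (1 − 2μ_max·ν'' + μ_max²·δ²)·‖x − y‖². Moreover, if ν ≤ δ then 1 − 2μ_max·ν'' + μ_max²·δ² ≥ 0. -/
open scoped RealInnerProductSpace

theorem PiLp.norm_le_mul_norm_of_forall_le {ι : Type*} [Fintype ι] {E : ι → Type*}
    [∀ k, NormedAddCommGroup (E k)] {C : ℝ} (hC : 0 ≤ C) {v w : PiLp 2 E}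
    (h : ∀ k, ‖v k‖ ≤ C * ‖w k‖) : ‖v‖ ≤ C * ‖w‖ := by
  refine (pow_le_pow_iff_left₀ (norm_nonneg _) (by positivity) two_ne_zero).mp ?_
  rw [mul_pow, PiLp.norm_sq_eq_of_L2, PiLp.norm_sq_eq_of_L2, Finset.mul_sum]
  refine Finset.sum_le_sum fun k _ => ?_
  rw [← mul_pow]
  exact pow_le_pow_left₀ (norm_nonneg _) (h k) 2

/-- **adaptation-step contraction estimate, Appendix E of the paper.**
If `F` is `ν`-strongly monotone and `δ`-Lipschitz, then with `ν'' = ν − t δ`,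
`‖(x − y) − U (F x − F y)‖² ≤ (1 − 2 μ_max ν'' + μ_max² δ²) ‖x − y‖²`; moreover if
`ν ≤ δ` then the contraction factor is nonnegative. -/
theorem adaptation_step_contraction
    {N : ℕ} (hN : 1 ≤ N) (E : Fin N → Type*)
    [∀ k, NormedAddCommGroup (E k)] [∀ k, InnerProductSpace ℝ (E k)]
    [∀ k, FiniteDimensional ℝ (E k)]
    (μ : Fin N → ℝ) (hμpos : ∀ k, 0 < μ k)
    (μmax : ℝ) (hμmax : IsGreatest (Set.range μ) μmax)
    (t : ℝ) (ht0 : 0 ≤ t) (ht1 : t < 1)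
    (hμmin : IsLeast (Set.range μ) ((1 - t) * μmax))
    (U : PiLp 2 E → PiLp 2 E) (hU : ∀ (x : PiLp 2 E) (k : Fin N), U x k = μ k • x k)
    (F : PiLp 2 E → PiLp 2 E) (ν δ : ℝ)
    (hmono : ∀ x y : PiLp 2 E, ν * ‖x - y‖ ^ 2 ≤ ⟪x - y, F x - F y⟫)
    (hlip : ∀ x y : PiLp 2 E, ‖F x - F y‖ ≤ δ * ‖x - y‖) :
    (∀ x y : PiLp 2 E,
      ‖(x - y) - U (F x - F y)‖ ^ 2 ≤
        (1 - 2 * μmax * (ν - t * δ) + μmax ^ 2 * δ ^ 2) * ‖x - y‖ ^ 2) ∧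
    (ν ≤ δ → 0 ≤ 1 - 2 * μmax * (ν - t * δ) + μmax ^ 2 * δ ^ 2) := by
  have hle : ∀ k, μ k ≤ μmax := fun k => hμmax.2 ⟨k, rfl⟩
  have hge : ∀ k, (1 - t) * μmax ≤ μ k := fun k => hμmin.2 ⟨k, rfl⟩
  have hm : 0 < μmax := (hμpos ⟨0, hN⟩).trans_le (hle _)
  refine ⟨fun x y => ?_, fun h => ?_⟩
  · have h1 := hmono x y
    have h2 := hlip x y
    generalize x - y = d at *
    generalize F x - F y = g at *
    have hUg : ‖U g‖ ≤ μmax * ‖g‖ := by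
      refine PiLp.norm_le_mul_norm_of_forall_le hm.le fun k => ?_
      rw [hU, norm_smul, Real.norm_of_nonneg (hμpos k).le]
      exact mul_le_mul_of_nonneg_right (hle k) (norm_nonneg _)
    have hVg : ‖μmax • g - U g‖ ≤ t * μmax * ‖g‖ := by
      refine PiLp.norm_le_mul_norm_of_forall_le (by positivity) fun k => ?_
      rw [PiLp.sub_apply, PiLp.smul_apply, hU, ← sub_smul, norm_smul,
        Real.norm_of_nonneg (sub_nonneg.2 (hle k))]
      exact mul_le_mul_of_nonneg_right (by linarith [hge k]) (norm_nonneg _)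
    have hUg_sq : ‖U g‖ ^ 2 ≤ μmax ^ 2 * δ ^ 2 * ‖d‖ ^ 2 := by
      calc ‖U g‖ ^ 2 ≤ (μmax * (δ * ‖d‖)) ^ 2 :=
            pow_le_pow_left₀ (norm_nonneg _) (hUg.trans (by gcongr)) 2
        _ = μmax ^ 2 * δ ^ 2 * ‖d‖ ^ 2 := by ring
    have hinner : μmax * ⟪d, g⟫ - ⟪d, U g⟫ ≤ t * μmax * δ * ‖d‖ ^ 2 := by
      calc μmax * ⟪d, g⟫ - ⟪d, U g⟫ = ⟪d, μmax • g - U g⟫ := by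
            rw [inner_sub_right, real_inner_smul_right]
        _ ≤ ‖d‖ * ‖μmax • g - U g‖ := real_inner_le_norm _ _
        _ ≤ ‖d‖ * (t * μmax * (δ * ‖d‖)) := by
            gcongr
            exact hVg.trans (by gcongr)
        _ = t * μmax * δ * ‖d‖ ^ 2 := by ring
    have hmono' := mul_le_mul_of_nonneg_left h1 hm.le
    rw [norm_sub_sq_real]
    linarith
  · have h1 := mul_le_mul_of_nonneg_left h hm.le
    have h2 := mul_nonneg (sub_nonneg.2 ht1.le) (sq_nonneg (1 - μmax * δ))
    have h3 := mul_nonneg ht0 (add_nonneg zero_le_one (sq_nonneg (μmax * δ)))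
    linarith
end

section
/- Let F : X → X be ν-strongly monotone and δ-Lipschitz, let P : X → X be monotone and δ_p-Lipschitz, let ρ ≥ 0, and let (c₁, c₂) equal (0, 1) or (1, 0). Define T : X → X by T(w) = ψ − c₂·ρ•U(P ψ), where ψ = φ − U(F φ) and φ = w − c₁·ρ•U(P w). Then, with ν'' = ν − t·δ, for all x, y ∈ X: ‖T x − T y‖² ≤ (1 + 2t·μ_max·ρ·δ_p + μ_max²·ρ²·δ_p²)·(1 − 2μ_max·ν'' + μ_max²·δ²)·‖x − y‖². -/
open scoped RealInnerProductSpace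

/-- A blockwise scaling by coefficients of modulus at most `C` is bounded by `C`. -/
theorem PiLp.norm_le_mul_norm_of_apply_eq_smul {ι : Type*} [Fintype ι] {E : ι → Type*}
    [∀ k, NormedAddCommGroup (E k)] [∀ k, InnerProductSpace ℝ (E k)] {a : ι → ℝ} {C : ℝ}
    (hC : 0 ≤ C) (ha : ∀ k, |a k| ≤ C) {g z : PiLp 2 E} (hz : ∀ k, z k = a k • g k) :
    ‖z‖ ≤ C * ‖g‖ := by
  refine (sq_le_sq₀ (norm_nonneg _) (by positivity)).1 ?_
  rw [mul_pow, PiLp.norm_sq_eq_of_L2, PiLp.norm_sq_eq_of_L2, Finset.mul_sum]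
  refine Finset.sum_le_sum fun k _ => ?_
  rw [hz, norm_smul, mul_pow, Real.norm_eq_abs]
  gcongr
  exact ha k

/-- Expansion estimate for `d - s • z`, where `z` approximates `m • g` up to relative error `t * m`
and `g` is controlled by `d` from both sides. -/
theorem norm_sub_smul_sq_le {H : Type*} [NormedAddCommGroup H] [InnerProductSpace ℝ H]
    {d g z : H} {m t s ν δ : ℝ} (hm : 0 ≤ m) (ht : 0 ≤ t) (hs : 0 ≤ s)
    (hz : ‖z‖ ≤ m * ‖g‖) (hr : ‖m • g - z‖ ≤ t * m * ‖g‖)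
    (hmono : ν * ‖d‖ ^ 2 ≤ ⟪d, g⟫) (hlip : ‖g‖ ≤ δ * ‖d‖) :
    ‖d - s • z‖ ^ 2 ≤ (1 - 2 * m * s * (ν - t * δ) + m ^ 2 * s ^ 2 * δ ^ 2) * ‖d‖ ^ 2 := by
  have h₁ : ⟪d, m • g - z⟫ ≤ ‖d‖ * (t * m * (δ * ‖d‖)) :=
    (real_inner_le_norm _ _).trans (by gcongr; exact hr.trans (by gcongr))
  have h₂ : m * (ν * ‖d‖ ^ 2) ≤ m * ⟪d, g⟫ := by gcongr
  have h₃ : ‖z‖ ^ 2 ≤ (m * (δ * ‖d‖)) ^ 2 := by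
    gcongr
    exact hz.trans (by gcongr)
  rw [inner_sub_right, real_inner_smul_right] at h₁
  rw [norm_sub_sq_real, real_inner_smul_right, norm_smul, mul_pow, Real.norm_eq_abs, sq_abs]
  have h₄ : s * (m * (ν * ‖d‖ ^ 2) - ‖d‖ * (t * m * (δ * ‖d‖))) ≤ s * ⟪d, z⟫ := by
    gcongr
    linarith
  have h₅ : s ^ 2 * ‖z‖ ^ 2 ≤ s ^ 2 * (m * (δ * ‖d‖)) ^ 2 := by gcongr
  linarith

/-- If `A` and `B` are squared Lipschitz constants of two maps, then `A * B` is one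
of the composition. -/
theorem norm_comp_sub_sq_le {H : Type*} [NormedAddCommGroup H] {S R : H → H} {A B : ℝ}
    (hS : ∀ x y, ‖S x - S y‖ ^ 2 ≤ A * ‖x - y‖ ^ 2)
    (hR : ∀ x y, ‖R x - R y‖ ^ 2 ≤ B * ‖x - y‖ ^ 2) (x y : H) :
    ‖S (R x) - S (R y)‖ ^ 2 ≤ A * B * ‖x - y‖ ^ 2 := by
  rcases eq_or_ne x y with rfl | hxy
  · simp
  have hd : 0 < ‖x - y‖ ^ 2 := by
    have := norm_pos_iff.2 (sub_ne_zero.2 hxy)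
    positivity
  have hA : 0 ≤ A := nonneg_of_mul_nonneg_left ((sq_nonneg _).trans (hS x y)) hd
  calc ‖S (R x) - S (R y)‖ ^ 2 ≤ A * ‖R x - R y‖ ^ 2 := hS _ _
    _ ≤ A * (B * ‖x - y‖ ^ 2) := by
      gcongr
      exact hR x y
    _ = A * B * ‖x - y‖ ^ 2 := by ring

/-- **contraction of the diffusion map, Appendix E of the paper.**
One iteration `T` of the deterministic Adapt-then-Penalize (`c₁ = 0, c₂ = 1`) or
Penalize-then-Adapt (`c₁ = 1, c₂ = 0`) strategy satisfies
`‖T x − T y‖² ≤ (1 + 2 t μ_max ρ δ_p + μ_max² ρ² δ_p²)(1 − 2 μ_max ν'' + μ_max² δ²) ‖x − y‖²`. -/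
theorem diffusion_map_contraction
    {N : ℕ} (hN : 1 ≤ N) (E : Fin N → Type*)
    [∀ k, NormedAddCommGroup (E k)] [∀ k, InnerProductSpace ℝ (E k)]
    [∀ k, FiniteDimensional ℝ (E k)]
    (μ : Fin N → ℝ) (hμpos : ∀ k, 0 < μ k)
    (μmax : ℝ) (hμmax : IsGreatest (Set.range μ) μmax)
    (t : ℝ) (ht0 : 0 ≤ t) (ht1 : t < 1)
    (hμmin : IsLeast (Set.range μ) ((1 - t) * μmax))
    (U : PiLp 2 E → PiLp 2 E) (hU : ∀ (x : PiLp 2 E) (k : Fin N), U x k = μ k • x k)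
    (F : PiLp 2 E → PiLp 2 E) (ν δ : ℝ)
    (hmono : ∀ x y : PiLp 2 E, ν * ‖x - y‖ ^ 2 ≤ ⟪x - y, F x - F y⟫)
    (hlip : ∀ x y : PiLp 2 E, ‖F x - F y‖ ≤ δ * ‖x - y‖)
    (P : PiLp 2 E → PiLp 2 E) (δp : ℝ)
    (hPmono : ∀ x y : PiLp 2 E, 0 ≤ ⟪x - y, P x - P y⟫)
    (hPlip : ∀ x y : PiLp 2 E, ‖P x - P y‖ ≤ δp * ‖x - y‖)
    (ρ : ℝ) (hρ : 0 ≤ ρ)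
    (c₁ c₂ : ℝ) (hc : (c₁ = 0 ∧ c₂ = 1) ∨ (c₁ = 1 ∧ c₂ = 0))
    (T : PiLp 2 E → PiLp 2 E)
    (hT : ∀ w : PiLp 2 E,
      T w = (fun ψ => ψ - (c₂ * ρ) • U (P ψ))
        ((fun φ => φ - U (F φ)) (w - (c₁ * ρ) • U (P w)))) :
    ∀ x y : PiLp 2 E,
      ‖T x - T y‖ ^ 2 ≤
        (1 + 2 * t * μmax * ρ * δp + μmax ^ 2 * ρ ^ 2 * δp ^ 2) *
          (1 - 2 * μmax * (ν - t * δ) + μmax ^ 2 * δ ^ 2) * ‖x - y‖ ^ 2 := by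
  have hm : 0 ≤ μmax := by
    obtain ⟨k, rfl⟩ := hμmax.1
    exact (hμpos k).le
  have hle (k : Fin N) : μ k ≤ μmax := hμmax.2 ⟨k, rfl⟩
  have hge (k : Fin N) : (1 - t) * μmax ≤ μ k := hμmin.2 ⟨k, rfl⟩
  have step (G : PiLp 2 E → PiLp 2 E) (s κ η : ℝ) (hs : 0 ≤ s)
      (hG : ∀ x y, κ * ‖x - y‖ ^ 2 ≤ ⟪x - y, G x - G y⟫)
      (hGlip : ∀ x y, ‖G x - G y‖ ≤ η * ‖x - y‖) (x y : PiLp 2 E) :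
      ‖(x - s • U (G x)) - (y - s • U (G y))‖ ^ 2 ≤
        (1 - 2 * μmax * s * (κ - t * η) + μmax ^ 2 * s ^ 2 * η ^ 2) * ‖x - y‖ ^ 2 := by
    have hz : ‖U (G x) - U (G y)‖ ≤ μmax * ‖G x - G y‖ :=
      PiLp.norm_le_mul_norm_of_apply_eq_smul (a := μ) hm
        (fun k => (abs_of_pos (hμpos k)).trans_le (hle k))
        fun k => by simp [hU, smul_sub]
    have hr : ‖μmax • (G x - G y) - (U (G x) - U (G y))‖ ≤ t * μmax * ‖G x - G y‖ :=
      PiLp.norm_le_mul_norm_of_apply_eq_smul (a := fun k => μmax - μ k) (mul_nonneg ht0 hm)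
        (fun k => by
          rw [abs_of_nonneg (sub_nonneg.2 (hle k))]
          linarith [hge k])
        fun k => by
          simp only [PiLp.sub_apply, PiLp.smul_apply, hU, smul_sub, sub_smul]
          abel
    have h := norm_sub_smul_sq_le hm ht0 hs hz hr (hG x y) (hGlip x y)
    rwa [smul_sub, sub_sub_sub_comm] at h
  have hA (x y : PiLp 2 E) : ‖(x - ρ • U (P x)) - (y - ρ • U (P y))‖ ^ 2 ≤
      (1 + 2 * t * μmax * ρ * δp + μmax ^ 2 * ρ ^ 2 * δp ^ 2) * ‖x - y‖ ^ 2 :=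
    (step P ρ 0 δp hρ (by simpa using hPmono) hPlip x y).trans_eq (by ring)
  have hB (x y : PiLp 2 E) : ‖(x - U (F x)) - (y - U (F y))‖ ^ 2 ≤
      (1 - 2 * μmax * (ν - t * δ) + μmax ^ 2 * δ ^ 2) * ‖x - y‖ ^ 2 := by
    simpa using step F 1 ν δ zero_le_one hmono hlip x y
  intro x y
  rcases hc with ⟨rfl, rfl⟩ | ⟨rfl, rfl⟩
  · simpa [hT] using norm_comp_sub_sq_le (S := fun w => w - ρ • U (P w))
      (R := fun w => w - U (F w)) hA hB x y
  · rw [mul_comm (1 + _ + _)]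
    simpa [hT] using norm_comp_sub_sq_le (S := fun w => w - U (F w))
      (R := fun w => w - ρ • U (P w)) hB hA x y
end

section
/- Let 0 < ν ≤ δ, δ_p > 0, and suppose ρ > δ/δ_p and 0 ≤ t < ν/(δ + ρδ_p). Set ν' = ν − t(δ + ρδ_p), ν'' = ν − tδ, and μ_o = min{ 2ν'/(δ² + ρ²δ_p² − 4tν''ρδ_p), (ν' + t(ρ²δ_p² − δ²)/(ρδ_p))/δ² }. Then for every real μ with 0 < μ < μ_o one has δ² + ρ²δ_p² − 4tν''ρδ_p > 0, 0 ≤ (1 + 2tμρδ_p + μ²ρ²δ_p²)·(1 − 2μν'' + μ²δ²) < 1. -/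
/-- **key algebraic inequality, Appendix E of the paper.**
Under `0 < ν ≤ δ`, `δ_p > 0`, `ρ > δ/δ_p` and `0 ≤ t < ν/(δ + ρδ_p)`, with
`ν' = ν − t(δ + ρδ_p)`, `ν'' = ν − tδ` and
`μ_o = min{2ν'/(δ² + ρ²δ_p² − 4tν''ρδ_p), (ν' + t(ρ²δ_p² − δ²)/(ρδ_p))/δ²}`,
every `0 < μ < μ_o` satisfies `δ² + ρ²δ_p² − 4tν''ρδ_p > 0` and
`0 ≤ (1 + 2tμρδ_p + μ²ρ²δ_p²)(1 − 2μν'' + μ²δ²) < 1`. -/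
theorem contraction_factor_lt_one
    (ν δ δp ρ t μ : ℝ)
    (hν : 0 < ν) (hνδ : ν ≤ δ) (hδp : 0 < δp)
    (hρ : δ / δp < ρ)
    (ht0 : 0 ≤ t) (ht1 : t < ν / (δ + ρ * δp))
    (hμ0 : 0 < μ)
    (hμo : μ < min
      (2 * (ν - t * (δ + ρ * δp)) / (δ ^ 2 + ρ ^ 2 * δp ^ 2 - 4 * t * (ν - t * δ) * ρ * δp))
      (((ν - t * (δ + ρ * δp)) + t * (ρ ^ 2 * δp ^ 2 - δ ^ 2) / (ρ * δp)) / δ ^ 2)) :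
    0 < δ ^ 2 + ρ ^ 2 * δp ^ 2 - 4 * t * (ν - t * δ) * ρ * δp ∧
    0 ≤ (1 + 2 * t * μ * ρ * δp + μ ^ 2 * ρ ^ 2 * δp ^ 2) *
          (1 - 2 * μ * (ν - t * δ) + μ ^ 2 * δ ^ 2) ∧
    (1 + 2 * t * μ * ρ * δp + μ ^ 2 * ρ ^ 2 * δp ^ 2) *
        (1 - 2 * μ * (ν - t * δ) + μ ^ 2 * δ ^ 2) < 1 := by
  have hδ : 0 < δ := hν.trans_le hνδ
  have hp : δ < ρ * δp := (div_lt_iff₀ hδp).1 hρ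
  obtain ⟨h1, h2⟩ := lt_min_iff.1 hμo
  simp only [← mul_pow, mul_assoc] at *
  generalize ρ * δp = p at *
  have hp0 : 0 < p := hδ.trans hp
  have hn : ν - t * δ ≤ δ * (1 - t) := by linarith
  have hn' : ν - t * δ ≤ δ := by linarith [mul_nonneg ht0 hδ.le]
  have hD : 0 < δ ^ 2 + p ^ 2 - 4 * (t * ((ν - t * δ) * p)) := by
    have h3 : t * p * (ν - t * δ) ≤ t * p * (δ * (1 - t)) :=
      mul_le_mul_of_nonneg_left hn (by positivity)
    have h4 : 0 ≤ δ * p * (1 - 2 * t) ^ 2 := by positivity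
    nlinarith [sq_nonneg (p - δ), mul_pos hδ hp0]
  rw [lt_div_iff₀ hD] at h1
  have h3 : μ * δ ^ 2 * p < (ν - t * δ) * p - t * δ ^ 2 := by
    rw [lt_div_iff₀ (by positivity)] at h2
    have h4 := mul_lt_mul_of_pos_right h2 hp0
    have h5 : (ν - t * (δ + p) + t * (p ^ 2 - δ ^ 2) / p) * p
        = (ν - t * δ) * p - t * δ ^ 2 := by
      field_simp
      ring
    linarith
  have h6 : 0 < μ * δ ^ 2 * p := by positivity
  refine ⟨by linarith, mul_nonneg (by positivity) ?_, ?_⟩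
  · nlinarith [sq_nonneg (1 - μ * δ), mul_le_mul_of_nonneg_left hn' hμ0.le]
  · have h7 := mul_pos hμ0 (sub_pos.2 h1)
    have h8 : 0 < μ ^ 3 * p * (2 * ((ν - t * δ) * p - t * δ ^ 2) - μ * δ ^ 2 * p) :=
      mul_pos (by positivity) (by linarith)
    linarith
end

section
/- Let F : X → X be ν-strongly monotone and δ-Lipschitz with 0 < ν ≤ δ, let P : X → X be monotone and δ_p-Lipschitz with δ_p > 0, let (c₁, c₂) equal (0, 1) or (1, 0), and define T : X → X by T(w) = ψ − c₂·ρ•U(P ψ), where ψ = φ − U(F φ) and φ = w − c₁·ρ•U(P w). Set ν' = ν − t(δ + ρδ_p), ν'' = ν − tδ, and μ_o = min{ 2ν'/(δ² + ρ²δ_p² − 4tν''ρδ_p), (ν' + t(ρ²δ_p² − δ²)/(ρδ_p))/δ² }. If ρ > δ/δ_p, t < ν/(δ + ρδ_p), and 0 < μ_max < μ_o, then T has a unique fixed point w^∞ ∈ X. -/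
open scoped RealInnerProductSpace

/-- A blockwise scaling by factors of absolute value at most `C` expands norms by at most `C`. -/
theorem PiLp.norm_le_of_blockwise_smul {ι : Type*} [Fintype ι] {E : ι → Type*}
    [∀ k, NormedAddCommGroup (E k)] [∀ k, InnerProductSpace ℝ (E k)]
    {m : ι → ℝ} {C : ℝ} (hC : 0 ≤ C) (hm : ∀ k, |m k| ≤ C) {x y : PiLp 2 E}
    (hxy : ∀ k, y k = m k • x k) : ‖y‖ ≤ C * ‖x‖ := by
  refine le_of_sq_le_sq ?_ (by positivity)
  rw [mul_pow, PiLp.norm_sq_eq_of_L2, PiLp.norm_sq_eq_of_L2, Finset.mul_sum]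
  refine Finset.sum_le_sum fun k _ => ?_
  rw [hxy, norm_smul, mul_pow, Real.norm_eq_abs]
  gcongr
  exact hm k

/-- Cauchy–Schwarz bound for the perturbation of an inner product by a nearly uniform blockwise
scaling. -/
theorem PiLp.le_inner_of_blockwise_smul {ι : Type*} [Fintype ι] {E : ι → Type*}
    [∀ k, NormedAddCommGroup (E k)] [∀ k, InnerProductSpace ℝ (E k)]
    {m : ι → ℝ} {M t : ℝ} (hM : 0 ≤ M) (ht : 0 ≤ t) (hle : ∀ k, m k ≤ M)
    (hge : ∀ k, (1 - t) * M ≤ m k) {d x y : PiLp 2 E} (hxy : ∀ k, y k = m k • x k) :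
    M * (⟪d, x⟫ - t * (‖d‖ * ‖x‖)) ≤ ⟪d, y⟫ := by
  have hdiff : ‖M • x - y‖ ≤ t * M * ‖x‖ := by
    refine PiLp.norm_le_of_blockwise_smul (m := fun k => M - m k) (by positivity) (fun k => ?_)
      fun k => ?_
    · rw [abs_of_nonneg (sub_nonneg.2 (hle k))]
      linarith [hge k]
    · simp [hxy, sub_smul]
  have hcs := (real_inner_le_norm d (M • x - y)).trans
    (mul_le_mul_of_nonneg_left hdiff (norm_nonneg d))
  rw [inner_sub_right, real_inner_smul_right] at hcs
  linarith

/-- Squared Lipschitz estimate for a blockwise scaled forward step `x ↦ x - U (G x)`. -/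
theorem PiLp.norm_sub_blockwise_step_sq_le {ι : Type*} [Fintype ι] {E : ι → Type*}
    [∀ k, NormedAddCommGroup (E k)] [∀ k, InnerProductSpace ℝ (E k)]
    {m : ι → ℝ} {M t : ℝ} (hM : 0 ≤ M) (ht : 0 ≤ t) (hm : ∀ k, 0 ≤ m k) (hle : ∀ k, m k ≤ M)
    (hge : ∀ k, (1 - t) * M ≤ m k) {U : PiLp 2 E → PiLp 2 E} (hU : ∀ x k, U x k = m k • x k)
    {G : PiLp 2 E → PiLp 2 E} {α L : ℝ}
    (hmono : ∀ x y, α * ‖x - y‖ ^ 2 ≤ ⟪x - y, G x - G y⟫)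
    (hlip : ∀ x y, ‖G x - G y‖ ≤ L * ‖x - y‖) (x y : PiLp 2 E) :
    ‖(x - U (G x)) - (y - U (G y))‖ ^ 2 ≤
      (1 - 2 * M * (α - t * L) + M ^ 2 * L ^ 2) * ‖x - y‖ ^ 2 := by
  have hblock : ∀ k, (U (G x) - U (G y)) k = m k • (G x - G y) k := fun k => by
    simp [hU, smul_sub]
  have hnorm : ‖U (G x) - U (G y)‖ ≤ M * (L * ‖x - y‖) :=
    (PiLp.norm_le_of_blockwise_smul hM (fun k => (abs_of_nonneg (hm k)).trans_le (hle k))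
      hblock).trans (mul_le_mul_of_nonneg_left (hlip x y) hM)
  have hsq := pow_le_pow_left₀ (norm_nonneg _) hnorm 2
  have hinner := PiLp.le_inner_of_blockwise_smul (d := x - y) hM ht hle hge hblock
  have hprod : t * (‖x - y‖ * ‖G x - G y‖) ≤ t * (‖x - y‖ * (L * ‖x - y‖)) := by
    gcongr
    exact hlip x y
  have hscaled := mul_le_mul_of_nonneg_left (sub_le_sub (hmono x y) hprod) hM
  rw [sub_sub_sub_comm, norm_sub_sq_real]
  linarith

/-- A self-map of a complete normed space that contracts squared distances by a factor below one
has a unique fixed point. -/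
theorem existsUnique_fixedPoint_of_norm_sub_sq_le {X : Type*} [NormedAddCommGroup X]
    [CompleteSpace X] {T : X → X} {q : ℝ} (hq : q < 1)
    (hT : ∀ x y, ‖T x - T y‖ ^ 2 ≤ q * ‖x - y‖ ^ 2) : ∃! x, T x = x := by
  have hcontr : ContractingWith (Real.toNNReal √q) T := by
    refine ⟨?_, LipschitzWith.of_dist_le_mul fun x y => ?_⟩
    · rw [Real.toNNReal_lt_one, Real.sqrt_lt' one_pos]
      simpa using hq
    · rw [Real.coe_toNNReal _ (Real.sqrt_nonneg q), dist_eq_norm, dist_eq_norm,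
        ← Real.sqrt_sq (norm_nonneg (x - y)), ← Real.sqrt_mul' q (sq_nonneg _)]
      exact Real.le_sqrt_of_sq_le (hT x y)
  exact ⟨_, hcontr.fixedPoint_isFixedPt, fun y hy => hcontr.fixedPoint_unique hy⟩

/-- The product of the squared Lipschitz constants of the adaptation step and the penalty step is
below one for admissible step-sizes; here `s` stands for `ρ * δp`. -/
theorem diffusion_contraction_factor_lt_one {M t ν δ s : ℝ} (hM : 0 < M) (ht0 : 0 ≤ t)
    (hν : 0 < ν) (hνδ : ν ≤ δ) (hδs : δ < s) (ht : t < ν / (δ + s))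
    (hM₁ : M < 2 * (ν - t * (δ + s)) / (δ ^ 2 + s ^ 2 - 4 * t * (ν - t * δ) * s))
    (hM₂ : M < ((ν - t * (δ + s)) + t * (s ^ 2 - δ ^ 2) / s) / δ ^ 2) :
    (1 - 2 * M * (ν - t * δ) + M ^ 2 * δ ^ 2) *
      (1 - 2 * M * (0 - t * s) + M ^ 2 * s ^ 2) < 1 := by
  have hδ : 0 < δ := hν.trans_le hνδ
  have hs : 0 < s := hδ.trans hδs
  have htν : t * (δ + s) < ν := (lt_div_iff₀ (by positivity)).1 ht
  have hden : 0 < δ ^ 2 + s ^ 2 - 4 * t * (ν - t * δ) * s := by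
    have htδ : t * δ ≤ t * s := by gcongr
    have h₁ : 2 * (t * s) * (ν - t * δ) ≤ s * δ := by
      have ht_half : 2 * t ≤ 1 := by nlinarith
      have : 2 * t * (ν - t * δ) ≤ 1 * δ :=
        mul_le_mul ht_half (by nlinarith) (by nlinarith) zero_le_one
      nlinarith
    nlinarith [sq_pos_of_pos (sub_pos.2 hδs)]
  have hquad := (lt_div_iff₀ hden).1 hM₁
  have hcubic : M * δ ^ 2 * s < (ν - t * δ) * s - t * δ ^ 2 := by
    have h := mul_lt_mul_of_pos_right ((lt_div_iff₀ (by positivity)).1 hM₂) hs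
    rw [add_mul, div_mul_cancel₀ _ hs.ne'] at h
    linarith
  have hpos : 0 < M * δ ^ 2 * s := by positivity
  have h₁ := mul_lt_mul_of_pos_left hquad hM
  have h₂ := mul_lt_mul_of_pos_left
    (show M * δ ^ 2 * s < 2 * ((ν - t * δ) * s - t * δ ^ 2) by linarith)
    (show 0 < M ^ 3 * s by positivity)
  linarith



/-- **Theorem 3 of the paper: unique fixed point.**
Under the step-size, spread and penalty conditions, the deterministic
Adapt-then-Penalize / Penalize-then-Adapt diffusion map `T` has a unique fixed
point `w^∞`. -/
theorem diffusion_unique_fixed_point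
    {N : ℕ} (hN : 1 ≤ N) (E : Fin N → Type*)
    [∀ k, NormedAddCommGroup (E k)] [∀ k, InnerProductSpace ℝ (E k)]
    [∀ k, FiniteDimensional ℝ (E k)]
    (μ : Fin N → ℝ) (hμpos : ∀ k, 0 < μ k)
    (μmax : ℝ) (hμmax : IsGreatest (Set.range μ) μmax)
    (t : ℝ) (ht0 : 0 ≤ t) (ht1 : t < 1)
    (hμmin : IsLeast (Set.range μ) ((1 - t) * μmax))
    (U : PiLp 2 E → PiLp 2 E) (hU : ∀ (x : PiLp 2 E) (k : Fin N), U x k = μ k • x k)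
    (F : PiLp 2 E → PiLp 2 E) (ν δ : ℝ) (hν : 0 < ν) (hνδ : ν ≤ δ)
    (hmono : ∀ x y : PiLp 2 E, ν * ‖x - y‖ ^ 2 ≤ ⟪x - y, F x - F y⟫)
    (hlip : ∀ x y : PiLp 2 E, ‖F x - F y‖ ≤ δ * ‖x - y‖)
    (P : PiLp 2 E → PiLp 2 E) (δp : ℝ) (hδp : 0 < δp)
    (hPmono : ∀ x y : PiLp 2 E, 0 ≤ ⟪x - y, P x - P y⟫)
    (hPlip : ∀ x y : PiLp 2 E, ‖P x - P y‖ ≤ δp * ‖x - y‖)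
    (ρ : ℝ)
    (c₁ c₂ : ℝ) (hc : (c₁ = 0 ∧ c₂ = 1) ∨ (c₁ = 1 ∧ c₂ = 0))
    (T : PiLp 2 E → PiLp 2 E)
    (hT : ∀ w : PiLp 2 E,
      T w = (fun ψ => ψ - (c₂ * ρ) • U (P ψ))
        ((fun φ => φ - U (F φ)) (w - (c₁ * ρ) • U (P w))))
    (hρ : δ / δp < ρ)
    (ht : t < ν / (δ + ρ * δp))
    (hμ1 : 0 < μmax)
    (hμ2 : μmax < min
      (2 * (ν - t * (δ + ρ * δp)) / (δ ^ 2 + ρ ^ 2 * δp ^ 2 - 4 * t * (ν - t * δ) * ρ * δp))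
      (((ν - t * (δ + ρ * δp)) + t * (ρ ^ 2 * δp ^ 2 - δ ^ 2) / (ρ * δp)) / δ ^ 2)) :
    ∃! winf : PiLp 2 E, T winf = winf := by
  have hδ : 0 < δ := hν.trans_le hνδ
  have hδs : δ < ρ * δp := (div_lt_iff₀ hδp).1 hρ
  have hρ0 : 0 < ρ := (div_pos hδ hδp).trans hρ
  have hle : ∀ k, μ k ≤ μmax := fun k => hμmax.2 ⟨k, rfl⟩
  have hge : ∀ k, (1 - t) * μmax ≤ μ k := fun k => hμmin.2 ⟨k, rfl⟩
  have hadapt := PiLp.norm_sub_blockwise_step_sq_le hμ1.le ht0 (fun k => (hμpos k).le) hle hge hU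
    hmono hlip
  have hpenalize := PiLp.norm_sub_blockwise_step_sq_le (G := fun x => ρ • P x) (α := 0)
    (L := ρ * δp) hμ1.le ht0 (fun k => (hμpos k).le) hle hge hU
    (fun x y => by
      rw [zero_mul, ← smul_sub, real_inner_smul_right]
      exact mul_nonneg hρ0.le (hPmono x y))
    (fun x y => by
      rw [← smul_sub, norm_smul, Real.norm_of_nonneg hρ0.le, mul_assoc]
      exact mul_le_mul_of_nonneg_left (hPlip x y) hρ0.le)
  have hsmul : ∀ x, U (ρ • x) = ρ • U x := fun x => by
    ext k
    simp only [hU, PiLp.smul_apply]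
    exact smul_comm _ _ _
  simp only [hsmul] at hpenalize
  have hfactor := diffusion_contraction_factor_lt_one (s := ρ * δp) hμ1 ht0 hν hνδ hδs ht
    (by simpa only [mul_pow, mul_assoc] using hμ2.trans_le (min_le_left _ _))
    (by simpa only [mul_pow, mul_assoc] using hμ2.trans_le (min_le_right _ _))
  have hadapt_nonneg : 0 ≤ 1 - 2 * μmax * (ν - t * δ) + μmax ^ 2 * δ ^ 2 := by
    have : μmax * (ν - t * δ) ≤ μmax * δ := by
      gcongr
      nlinarith
    nlinarith [sq_nonneg (1 - μmax * δ)]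
  have hpenalize_nonneg :
      0 ≤ 1 - 2 * μmax * (0 - t * (ρ * δp)) + μmax ^ 2 * (ρ * δp) ^ 2 := by
    have : 0 ≤ 2 * μmax * (t * (ρ * δp)) := by positivity
    nlinarith [sq_nonneg (μmax * (ρ * δp))]
  have : CompleteSpace (PiLp 2 E) := FiniteDimensional.complete ℝ _
  refine existsUnique_fixedPoint_of_norm_sub_sq_le hfactor fun x y => ?_
  rcases hc with ⟨rfl, rfl⟩ | ⟨rfl, rfl⟩
  · simp only [hT, zero_mul, one_mul, zero_smul, sub_zero]
    refine (hpenalize _ _).trans ?_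
    exact (mul_le_mul_of_nonneg_left (hadapt x y) hpenalize_nonneg).trans_eq (by ring)
  · simp only [hT, zero_mul, one_mul, zero_smul, sub_zero]
    refine (hadapt _ _).trans ?_
    exact (mul_le_mul_of_nonneg_left (hpenalize x y) hadapt_nonneg).trans_eq (by ring)
end

section
/- Let F : X → X be ν-strongly monotone and δ-Lipschitz with 0 < ν ≤ δ, let P : X → X be monotone and δ_p-Lipschitz with δ_p > 0, let ρ > 0, and let (c₁, c₂) equal (0, 1) or (1, 0). Let w⋆ ∈ X satisfy F(w⋆) + ρ•P(w⋆) = 0, and let w^∞ ∈ X be a fixed point of the map T(w) = ψ − c₂·ρ•U(P ψ) with ψ = φ − U(F φ), φ = w − c₁·ρ•U(P w). Set μ = μ_max, ν'' = ν − tδ, 𝒳 = 1 − 2μν'' + μ²δ², 𝒴 = 1 + 2tμρδ_p + μ²ρ²δ_p², 𝒵 = c₁(1 + μδ)δ + c₂(1 + μρδ_p)ρδ_p, a₁ = 1 − 𝒴·𝒳, b = 2μ²·‖F(w⋆)‖·√𝒴·𝒵, and η = μ⁴·(c₁δ² + c₂ρ²δ_p²)·‖F(w⋆)‖². If a₁ >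 0, then ‖w⋆ − w^∞‖ ≤ b/a₁ + √(η/a₁ + b²/a₁²). -/
open scoped RealInnerProductSpace

section BlockScaling

variable {N : ℕ} {E : Fin N → Type*} [∀ k, NormedAddCommGroup (E k)]
  [∀ k, InnerProductSpace ℝ (E k)]

/-- A blockwise scaling with factors bounded by `m` in absolute value has norm at most `m`. -/
theorem norm_le_of_blockwise_scaling {c : Fin N → ℝ} {m : ℝ} (hm : 0 ≤ m)
    (hc : ∀ k, |c k| ≤ m) {x y : PiLp 2 E} (hxy : ∀ k, y k = c k • x k) :
    ‖y‖ ≤ m * ‖x‖ := by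
  refine le_of_sq_le_sq ?_ (by positivity)
  rw [mul_pow, PiLp.norm_sq_eq_of_L2, PiLp.norm_sq_eq_of_L2, Finset.mul_sum]
  refine Finset.sum_le_sum fun k _ => ?_
  rw [hxy, norm_smul, mul_pow, Real.norm_eq_abs]
  gcongr
  exact hc k

/-- A blockwise scaling with factors in `[(1 - t) * m, m]` deviates from multiplication by `m`
by at most `t * m` inside an inner product. -/
theorem inner_blockwise_scaling_ge {c : Fin N → ℝ} {m t : ℝ} (hm : 0 ≤ m) (ht : 0 ≤ t)
    (hcm : ∀ k, c k ≤ m) (hcl : ∀ k, (1 - t) * m ≤ c k) {x y d : PiLp 2 E}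
    (hxy : ∀ k, y k = c k • x k) :
    m * ⟪d, x⟫ - t * m * (‖d‖ * ‖x‖) ≤ ⟪d, y⟫ := by
  have hdiff : ‖m • x - y‖ ≤ t * m * ‖x‖ := by
    refine norm_le_of_blockwise_scaling (c := fun k => m - c k) (by positivity) (fun k => ?_)
      (fun k => ?_)
    · rw [abs_of_nonneg (sub_nonneg.2 (hcm k))]
      linarith [hcl k]
    · rw [PiLp.sub_apply, PiLp.smul_apply, hxy, sub_smul]
  have hinner : ⟪d, m • x - y⟫ = m * ⟪d, x⟫ - ⟪d, y⟫ := by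
    rw [inner_sub_right, real_inner_smul_right]
  have hcs := real_inner_le_norm d (m • x - y)
  have := mul_le_mul_of_nonneg_left hdiff (norm_nonneg d)
  linarith

end BlockScaling

section Diffusion

variable {H : Type*} [NormedAddCommGroup H] [InnerProductSpace ℝ H]

/-- The squared Lipschitz constant of a scaled forward step along a strongly monotone
Lipschitz map. -/
theorem norm_sub_forward_step_sq_le {U G : H → H} {m t ν δ : ℝ} (hm : 0 ≤ m) (ht : 0 ≤ t)
    (hUsub : ∀ x y, U (x - y) = U x - U y) (hUnorm : ∀ x, ‖U x‖ ≤ m * ‖x‖)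
    (hUinner : ∀ d x, m * ⟪d, x⟫ - t * m * (‖d‖ * ‖x‖) ≤ ⟪d, U x⟫)
    (hmono : ∀ x y, ν * ‖x - y‖ ^ 2 ≤ ⟪x - y, G x - G y⟫)
    (hlip : ∀ x y, ‖G x - G y‖ ≤ δ * ‖x - y‖) (x y : H) :
    ‖(x - U (G x)) - (y - U (G y))‖ ^ 2
      ≤ (1 - 2 * m * (ν - t * δ) + m ^ 2 * δ ^ 2) * ‖x - y‖ ^ 2 := by
  have hsplit : (x - U (G x)) - (y - U (G y)) = (x - y) - U (G x - G y) := by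
    rw [hUsub]; abel
  rw [hsplit, norm_sub_sq_real]
  have hnorm : ‖U (G x - G y)‖ ≤ m * (δ * ‖x - y‖) :=
    (hUnorm _).trans (mul_le_mul_of_nonneg_left (hlip x y) hm)
  have hsq := pow_le_pow_left₀ (norm_nonneg _) hnorm 2
  have hinner := hUinner (x - y) (G x - G y)
  have hmono' := mul_le_mul_of_nonneg_left (hmono x y) hm
  have hcross := mul_le_mul_of_nonneg_left
    (mul_le_mul_of_nonneg_left (hlip x y) (norm_nonneg (x - y))) (mul_nonneg ht hm)
  linear_combination hsq + 2 * hinner + 2 * hmono' + 2 * hcross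

/-- The quadratic inequality satisfied by the distance between a zero `w` of `G₁ + G₂` and a
fixed point `v` of the composition of the scaled forward steps along `G₁` and then `G₂`. -/
theorem norm_sub_fixedPoint_sq_le {U G₁ G₂ : H → H} {m κ p q : ℝ} (hm : 0 ≤ m) (hκ : 0 ≤ κ)
    (hUsub : ∀ x y, U (x - y) = U x - U y) (hUnorm : ∀ x, ‖U x‖ ≤ m * ‖x‖)
    (hlip : ∀ x y, ‖G₂ x - G₂ y‖ ≤ κ * ‖x - y‖)
    (h₁ : ∀ x y, ‖(x - U (G₁ x)) - (y - U (G₁ y))‖ ^ 2 ≤ p * ‖x - y‖ ^ 2)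
    (h₂ : ∀ x y, ‖(x - U (G₂ x)) - (y - U (G₂ y))‖ ^ 2 ≤ q * ‖x - y‖ ^ 2)
    (hq : 0 ≤ q) (hqp : q * p ≤ 1) {w v : H} (hw : G₁ w + G₂ w = 0)
    (hv : v = (v - U (G₁ v)) - U (G₂ (v - U (G₁ v)))) :
    ‖w - v‖ ^ 2 ≤ q * p * ‖w - v‖ ^ 2 + 2 * (m ^ 2 * κ * ‖G₁ w‖) * ‖w - v‖
      + (m ^ 2 * κ * ‖G₁ w‖) ^ 2 := by
  set φ := w - U (G₁ w) with hφ
  set ψ := v - U (G₁ v) with hψ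
  set r := (φ - U (G₂ φ)) - (ψ - U (G₂ ψ)) with hr
  set s := U (G₂ φ - G₂ w) with hs
  have hU0 : U (0 : H) = 0 := by simpa using hUsub 0 0
  have hUw : U (G₂ w) = -U (G₁ w) := by
    rw [eq_neg_of_add_eq_zero_right hw, ← zero_sub, hUsub, hU0, zero_sub]
  have hsum : w - v = r + s := by
    rw [hr, ← hv, hs, hUsub, hUw, hφ]; abel
  have hs_norm : ‖s‖ ≤ m ^ 2 * κ * ‖G₁ w‖ := by
    have hφw : ‖φ - w‖ ≤ m * ‖G₁ w‖ := by
      rw [hφ, sub_sub_cancel_left, norm_neg]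
      exact hUnorm _
    calc ‖s‖ ≤ m * ‖G₂ φ - G₂ w‖ := hUnorm _
      _ ≤ m * (κ * (m * ‖G₁ w‖)) := by
        gcongr
        exact (hlip φ w).trans (mul_le_mul_of_nonneg_left hφw hκ)
      _ = m ^ 2 * κ * ‖G₁ w‖ := by ring
  have hr_sq : ‖r‖ ^ 2 ≤ q * p * ‖w - v‖ ^ 2 := by
    rw [mul_assoc]
    exact (h₂ φ ψ).trans (mul_le_mul_of_nonneg_left (h₁ w v) hq)
  have hr_norm : ‖r‖ ≤ ‖w - v‖ := by
    refine le_of_sq_le_sq (hr_sq.trans ?_) (norm_nonneg _)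
    exact mul_le_of_le_one_left (sq_nonneg _) hqp
  have hcross : ⟪r, s⟫ ≤ ‖w - v‖ * (m ^ 2 * κ * ‖G₁ w‖) :=
    (real_inner_le_norm r s).trans
      (mul_le_mul hr_norm hs_norm (norm_nonneg _) (norm_nonneg _))
  have hs_sq := pow_le_pow_left₀ (norm_nonneg _) hs_norm 2
  have hexp : ‖w - v‖ ^ 2 = ‖r‖ ^ 2 + 2 * ⟪r, s⟫ + ‖s‖ ^ 2 := by
    rw [hsum, norm_add_sq_real]
  linarith

end Diffusion

/-- A bound on the solutions of a quadratic inequality. -/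
theorem le_div_add_sqrt_of_mul_sq_le {a b c x : ℝ} (ha : 0 < a) (hb : 0 ≤ b)
    (h : a * x ^ 2 ≤ b * x + c) (hx : 0 ≤ x) :
    x ≤ b / a + Real.sqrt (c / a + b ^ 2 / a ^ 2) := by
  have hmain : x - b / a ≤ Real.sqrt (c / a + b ^ 2 / a ^ 2) := by
    refine Real.le_sqrt_of_sq_le ?_
    have hdiv : x ^ 2 ≤ b / a * x + c / a := by
      rw [div_mul_eq_mul_div, ← add_div, le_div_iff₀ ha]
      linarith
    have hbax : 0 ≤ b / a * x := by positivity
    have hpow : b ^ 2 / a ^ 2 = (b / a) ^ 2 := by rw [div_pow]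
    rw [hpow]
    linear_combination hdiv + hbax
  linarith

/-- **Theorem 5 of the paper: explicit bias bound.**
If `w⋆` is the zero of the penalized pseudo-gradient `F + ρ P` and `w^∞` is a fixed
point of the deterministic Adapt-then-Penalize / Penalize-then-Adapt diffusion map,
then whenever `a₁ = 1 − 𝒴𝒳 > 0` one has
`‖w⋆ − w^∞‖ ≤ b/a₁ + √(η/a₁ + b²/a₁²)`. -/
theorem diffusion_bias_bound
    {N : ℕ} (hN : 1 ≤ N) (E : Fin N → Type*)
    [∀ k, NormedAddCommGroup (E k)] [∀ k, InnerProductSpace ℝ (E k)]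
    [∀ k, FiniteDimensional ℝ (E k)]
    (μ : Fin N → ℝ) (hμpos : ∀ k, 0 < μ k)
    (μmax : ℝ) (hμmax : IsGreatest (Set.range μ) μmax)
    (t : ℝ) (ht0 : 0 ≤ t) (ht1 : t < 1)
    (hμmin : IsLeast (Set.range μ) ((1 - t) * μmax))
    (U : PiLp 2 E → PiLp 2 E) (hU : ∀ (x : PiLp 2 E) (k : Fin N), U x k = μ k • x k)
    (F : PiLp 2 E → PiLp 2 E) (ν δ : ℝ) (hν : 0 < ν) (hνδ : ν ≤ δ)
    (hmono : ∀ x y : PiLp 2 E, ν * ‖x - y‖ ^ 2 ≤ ⟪x - y, F x - F y⟫)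
    (hlip : ∀ x y : PiLp 2 E, ‖F x - F y‖ ≤ δ * ‖x - y‖)
    (P : PiLp 2 E → PiLp 2 E) (δp : ℝ) (hδp : 0 < δp)
    (hPmono : ∀ x y : PiLp 2 E, 0 ≤ ⟪x - y, P x - P y⟫)
    (hPlip : ∀ x y : PiLp 2 E, ‖P x - P y‖ ≤ δp * ‖x - y‖)
    (ρ : ℝ) (hρ : 0 < ρ)
    (c₁ c₂ : ℝ) (hc : (c₁ = 0 ∧ c₂ = 1) ∨ (c₁ = 1 ∧ c₂ = 0))
    (wstar : PiLp 2 E) (hstar : F wstar + ρ • P wstar = 0)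
    (winf : PiLp 2 E)
    (hfix : winf =
      (fun ψ => ψ - (c₂ * ρ) • U (P ψ))
        ((fun φ => φ - U (F φ)) (winf - (c₁ * ρ) • U (P winf))))
    -- abbreviations
    (𝒳 𝒴 𝒵 a₁ b η : ℝ)
    (h𝒳 : 𝒳 = 1 - 2 * μmax * (ν - t * δ) + μmax ^ 2 * δ ^ 2)
    (h𝒴 : 𝒴 = 1 + 2 * t * μmax * ρ * δp + μmax ^ 2 * ρ ^ 2 * δp ^ 2)
    (h𝒵 : 𝒵 = c₁ * (1 + μmax * δ) * δ + c₂ * (1 + μmax * ρ * δp) * ρ * δp)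
    (ha₁ : a₁ = 1 - 𝒴 * 𝒳)
    (hb : b = 2 * μmax ^ 2 * ‖F wstar‖ * Real.sqrt 𝒴 * 𝒵)
    (hη : η = μmax ^ 4 * (c₁ * δ ^ 2 + c₂ * ρ ^ 2 * δp ^ 2) * ‖F wstar‖ ^ 2)
    (ha₁pos : 0 < a₁) :
    ‖wstar - winf‖ ≤ b / a₁ + Real.sqrt (η / a₁ + b ^ 2 / a₁ ^ 2) := by
  have hm : 0 < μmax := by
    obtain ⟨k, hk⟩ := hμmax.1
    exact hk ▸ hμpos k
  have hδ : 0 < δ := hν.trans_le hνδ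
  have hμle (k : Fin N) : μ k ≤ μmax := hμmax.2 ⟨k, rfl⟩
  have hμge (k : Fin N) : (1 - t) * μmax ≤ μ k := hμmin.2 ⟨k, rfl⟩
  have hUsub (x y : PiLp 2 E) : U (x - y) = U x - U y := by
    ext k
    simp only [hU, PiLp.sub_apply, smul_sub]
  have hUsmul (r : ℝ) (x : PiLp 2 E) : U (r • x) = r • U x := by
    ext k
    simp only [hU, PiLp.smul_apply, smul_comm r]
  have hUnorm (x : PiLp 2 E) : ‖U x‖ ≤ μmax * ‖x‖ :=
    norm_le_of_blockwise_scaling hm.le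
      (fun k => (abs_of_pos (hμpos k)).trans_le (hμle k)) (hU x)
  have hUinner (d x : PiLp 2 E) :
      μmax * ⟪d, x⟫ - t * μmax * (‖d‖ * ‖x‖) ≤ ⟪d, U x⟫ :=
    inner_blockwise_scaling_ge hm.le ht0 hμle hμge (hU x)
  have hρPlip (x y : PiLp 2 E) : ‖ρ • P x - ρ • P y‖ ≤ ρ * δp * ‖x - y‖ := by
    rw [← smul_sub, norm_smul, Real.norm_of_nonneg hρ.le, mul_assoc]
    exact mul_le_mul_of_nonneg_left (hPlip x y) hρ.le
  have hρPmono (x y : PiLp 2 E) : 0 * ‖x - y‖ ^ 2 ≤ ⟪x - y, ρ • P x - ρ • P y⟫ := by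
    rw [← smul_sub, real_inner_smul_right, zero_mul]
    exact mul_nonneg hρ.le (hPmono x y)
  have hstepF (x y : PiLp 2 E) :
      ‖(x - U (F x)) - (y - U (F y))‖ ^ 2 ≤ 𝒳 * ‖x - y‖ ^ 2 :=
    h𝒳 ▸ norm_sub_forward_step_sq_le hm.le ht0 hUsub hUnorm hUinner hmono hlip x y
  have hstepP (x y : PiLp 2 E) :
      ‖(x - U (ρ • P x)) - (y - U (ρ • P y))‖ ^ 2 ≤ 𝒴 * ‖x - y‖ ^ 2 := by
    refine (norm_sub_forward_step_sq_le (G := fun z => ρ • P z) hm.le ht0 hUsub hUnorm hUinner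
      hρPmono hρPlip x y).trans_eq ?_
    rw [h𝒴]; ring
  have h𝒳0 : 0 ≤ 𝒳 := by
    have hsq : ν ^ 2 ≤ δ ^ 2 := pow_le_pow_left₀ hν.le hνδ 2
    have hmsq := mul_le_mul_of_nonneg_left hsq (sq_nonneg μmax)
    have htδ : 0 ≤ μmax * (t * δ) := by positivity
    rw [h𝒳]
    linear_combination hmsq + 2 * htδ + sq_nonneg (1 - μmax * ν)
  have h𝒴1 : 1 ≤ 𝒴 := by
    have h1 : 0 ≤ 2 * t * μmax * ρ * δp := by positivity
    have h2 : 0 ≤ μmax ^ 2 * ρ ^ 2 * δp ^ 2 := by positivity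
    linarith
  have hsqrt : 1 ≤ Real.sqrt 𝒴 := Real.one_le_sqrt.2 h𝒴1
  have hfP : ‖ρ • P wstar‖ = ‖F wstar‖ := by
    rw [eq_neg_of_add_eq_zero_right hstar, norm_neg]
  obtain ⟨κ, hκ, hκ𝒵, hηκ, hquad⟩ : ∃ κ : ℝ, 0 ≤ κ ∧ κ ≤ 𝒵 ∧
      η = (μmax ^ 2 * κ * ‖F wstar‖) ^ 2 ∧
      ‖wstar - winf‖ ^ 2 ≤ 𝒴 * 𝒳 * ‖wstar - winf‖ ^ 2
        + 2 * (μmax ^ 2 * κ * ‖F wstar‖) * ‖wstar - winf‖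
        + (μmax ^ 2 * κ * ‖F wstar‖) ^ 2 := by
    rcases hc with ⟨rfl, rfl⟩ | ⟨rfl, rfl⟩
    · refine ⟨ρ * δp, by positivity, ?_, by rw [hη]; ring, ?_⟩
      · have : 0 ≤ μmax * (ρ * δp) ^ 2 := by positivity
        rw [h𝒵]
        linear_combination this
      · refine norm_sub_fixedPoint_sq_le (G₂ := fun z => ρ • P z) hm.le (by positivity) hUsub
          hUnorm hρPlip hstepF hstepP (by linarith) (by linarith) hstar ?_
        simpa [hUsmul] using hfix
    · refine ⟨δ, hδ.le, ?_, by rw [hη]; ring, ?_⟩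
      · have : 0 ≤ μmax * δ ^ 2 := by positivity
        rw [h𝒵]
        linear_combination this
      · rw [← hfP, mul_comm 𝒴 𝒳]
        refine norm_sub_fixedPoint_sq_le (G₁ := fun z => ρ • P z) hm.le hδ.le hUsub
          hUnorm hlip hstepP hstepF h𝒳0 (by linarith) ((add_comm _ _).trans hstar) ?_
        simpa [hUsmul] using hfix
  have hbκ : 2 * (μmax ^ 2 * κ * ‖F wstar‖) ≤ b := by
    have hle : κ ≤ Real.sqrt 𝒴 * 𝒵 :=
      hκ𝒵.trans (le_mul_of_one_le_left (hκ.trans hκ𝒵) hsqrt)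
    have := mul_le_mul_of_nonneg_left hle (by positivity : 0 ≤ 2 * μmax ^ 2 * ‖F wstar‖)
    rw [hb]
    linear_combination this
  have hb0 : 0 ≤ b := le_trans (by positivity) hbκ
  refine le_div_add_sqrt_of_mul_sq_le ha₁pos hb0 ?_ (norm_nonneg _)
  have := mul_le_mul_of_nonneg_right hbκ (norm_nonneg (wstar - winf))
  rw [ha₁, hηκ]
  linear_combination hquad + this
end
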